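/- arXiv:1103.2078 — 4 statements merged into one kernel-verified Lean document; each statement's English description precedes it below -/
import Mathlib

section
/- The function L increases only on the zero set of y: the Lebesgue–Stieltjes measure dL of the set {t ∈ [0,T] : y(t) > 0} is zero; equivalently, ∫_{[0,T]} y(t) dL(t) = 0. -/
open Set MeasureTheory

/-- The nonnegative part of the running maximum of a continuous function is the least upper bound
of `0` and the values of the function. -/
lemma isLUB_max_zero_sSup_image_Icc {g : ℝ → ℝ} {t : ℝ} (ht : 0 ≤ t)
    (hg : ContinuousOn g (Icc 0 t)) :
    IsLUB (insert 0 (g '' Icc 0 t)) (max 0 (sSup (g '' Icc 0 t))) :=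
  (isLUB_csSup ((nonempty_Icc.2 ht).image g) (isCompact_Icc.image_of_continuousOn hg).bddAbove).insert 0

/-- The Skorohod reflection term `L` increases only on `{y = 0}`: the
Lebesgue–Stieltjes measure `dL` of `{t ∈ [0,T] : y(t) > 0}` is zero; equivalently
`∫_{[0,T]} y dL = 0`.  Here `μ` is the Lebesgue–Stieltjes measure of `L`,
characterized by `μ([a,b]) = L(b) − L(a)` for subintervals of `[0,T]`. -/
theorem skorohod_flat_off (T η : ℝ) (hT : 0 < T) (hη : 0 ≤ η)
    (x : ℝ → ℝ) (hx : ContinuousOn x (Icc 0 T)) (hx0 : x 0 = 0)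
    (L y : ℝ → ℝ)
    (hL : ∀ t ∈ Icc 0 T, L t = max 0 (sSup ((fun s => -(η + x s)) '' Icc 0 t)))
    (hy : ∀ t ∈ Icc 0 T, y t = η + x t + L t)
    (μ : Measure ℝ)
    (hμ : ∀ a b : ℝ, 0 ≤ a → a ≤ b → b ≤ T →
      μ (Icc a b) = ENNReal.ofReal (L b - L a)) :
    μ {t ∈ Icc 0 T | 0 < y t} = 0 ∧ (∫ t in Icc 0 T, y t ∂μ) = 0 := by
  set g : ℝ → ℝ := fun s => -(η + x s) with hg_def
  have hg : ContinuousOn g (Icc 0 T) := (continuousOn_const.add hx).neg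
  have hLUB : ∀ t ∈ Icc 0 T, IsLUB (insert 0 (g '' Icc 0 t)) (L t) := fun t ht => by
    rw [hL t ht]
    exact isLUB_max_zero_sSup_image_Icc ht.1 (hg.mono (Icc_subset_Icc_right ht.2))
  have hnonneg : ∀ t ∈ Icc 0 T, 0 ≤ L t := fun t ht => (hLUB t ht).1 (mem_insert _ _)
  have hle : ∀ t ∈ Icc 0 T, ∀ s ∈ Icc 0 t, g s ≤ L t := fun t ht s hs =>
    (hLUB t ht).1 (mem_insert_of_mem _ (mem_image_of_mem g hs))
  have hleast : ∀ t ∈ Icc 0 T, ∀ M, 0 ≤ M → (∀ s ∈ Icc 0 t, g s ≤ M) → L t ≤ M := by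
    intro t ht M hM h
    refine (hLUB t ht).2 ?_
    rintro _ (rfl | ⟨s, hs, rfl⟩)
    exacts [hM, h s hs]
  have hy' : ∀ t ∈ Icc 0 T, y t = L t - g t := fun t ht => by
    rw [hy t ht, hg_def]
    ring
  have hnull : μ {t ∈ Icc 0 T | 0 < y t} = 0 := by
    refine measure_null_of_locally_null _ fun t ⟨ht, hyt⟩ => ?_
    rw [hy' t ht, sub_pos] at hyt
    obtain ⟨c, hgc, hcL⟩ := exists_between hyt
    obtain ⟨δ, hδ, hball⟩ :=
      (nhdsWithin_hasBasis Metric.nhds_basis_closedBall _).mem_iff.1 ((hg t ht).eventually_lt_const hgc)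
    rw [Real.closedBall_eq_Icc] at hball
    have ha : max 0 (t - δ) ∈ Icc 0 T :=
      ⟨le_max_left _ _, max_le hT.le (by linarith [ht.2])⟩
    have hb : min T (t + δ) ∈ Icc 0 T :=
      ⟨le_min hT.le (by linarith [ht.1]), min_le_left _ _⟩
    have hat : max 0 (t - δ) ≤ t := max_le ht.1 (by linarith)
    have htb : t ≤ min T (t + δ) := le_min ht.2 (by linarith)
    have hcb : c < L (min T (t + δ)) := hcL.trans_le <|
      hleast t ht _ (hnonneg _ hb) fun s hs => hle _ hb s ⟨hs.1, hs.2.trans htb⟩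
    have hmax : L (min T (t + δ)) ≤ max (L (max 0 (t - δ))) c := by
      refine hleast _ hb _ (le_max_of_le_left (hnonneg _ ha)) fun s hs => ?_
      rcases le_total s (max 0 (t - δ)) with hsa | hsa
      · exact le_max_of_le_left (hle _ ha s ⟨hs.1, hsa⟩)
      · exact le_max_of_le_right (le_of_lt (hball
          ⟨⟨(le_max_right _ _).trans hsa, hs.2.trans (min_le_right _ _)⟩,
            hs.1, hs.2.trans (min_le_left _ _)⟩))
    refine ⟨Icc (max 0 (t - δ)) (min T (t + δ)), ?_, ?_⟩
    · refine Filter.mem_of_superset (inter_mem_nhdsWithin _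
        (Icc_mem_nhds (sub_lt_self t hδ) (lt_add_of_pos_right t hδ))) ?_
      rintro s ⟨⟨hs, -⟩, hsδ⟩
      exact ⟨max_le hs.1 hsδ.1, le_min hs.2 hsδ.2⟩
    · rw [hμ _ _ ha.1 (hat.trans htb) hb.2, ENNReal.ofReal_eq_zero, sub_nonpos]
      exact (le_max_iff.1 hmax).resolve_right hcb.not_ge
  refine ⟨hnull, integral_eq_zero_of_ae ((ae_restrict_iff' measurableSet_Icc).2 ?_)⟩
  filter_upwards [measure_eq_zero_iff_ae_notMem.1 hnull] with t hnot ht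
  refine le_antisymm (not_lt.1 fun h => hnot ⟨ht, h⟩) ?_
  rw [hy' t ht]
  exact sub_nonneg.2 (hle t ht t ⟨ht.1, le_rfl⟩)
end

section
/- The function K increases only where h(t) + K(T) − K(t) = 0: the Lebesgue–Stieltjes measure dK of the set {t ∈ [0,T] : h(t) + K(T) − K(t) > 0} is zero; equivalently, ∫_{[0,T]} (h(t) + K(T) − K(t)) dK(t) = 0. -/
open Set MeasureTheory Filter Topology

/-- Future running maximum of `g` on `[t, T]`, floored at zero. -/
noncomputable def futureMax (g : ℝ → ℝ) (T t : ℝ) : ℝ :=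
  max 0 (sSup (g '' Icc t T))

lemma futureMax_le {g : ℝ → ℝ} {T t c : ℝ} (hc : 0 ≤ c)
    (hg : ∀ s ∈ Icc t T, g s ≤ c) : futureMax g T t ≤ c :=
  max_le hc (Real.sSup_le (forall_mem_image.2 hg) hc)

lemma le_futureMax {g : ℝ → ℝ} {T t s : ℝ} (hb : BddAbove (g '' Icc t T))
    (hs : s ∈ Icc t T) : g s ≤ futureMax g T t :=
  (le_csSup hb (mem_image_of_mem g hs)).trans (le_max_right _ _)

lemma futureMax_anti {g : ℝ → ℝ} {T a b : ℝ} (hb : BddAbove (g '' Icc a T)) (hab : a ≤ b) :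
    futureMax g T b ≤ futureMax g T a :=
  futureMax_le (le_max_left _ _) fun _ hs => le_futureMax hb ⟨hab.trans hs.1, hs.2⟩

lemma futureMax_self {g : ℝ → ℝ} {T : ℝ} (hg : g T ≤ 0) : futureMax g T T = 0 := by
  simp [futureMax, hg]

/-- The future maximum is constant on an interval where `g` stays below a level that the
future maximum exceeds at some interior time. -/
lemma futureMax_eq_of_lt {g : ℝ → ℝ} {T a t b c : ℝ} (hb : BddAbove (g '' Icc a T))
    (hat : a ≤ t) (htb : t ≤ b) (hg : ∀ s ∈ Icc a b, g s ≤ c) (hc : c < futureMax g T t) :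
    futureMax g T a = futureMax g T b := by
  refine le_antisymm ?_ (futureMax_anti hb (hat.trans htb))
  have hb' : BddAbove (g '' Icc b T) :=
    hb.mono (image_mono (Icc_subset_Icc_left (hat.trans htb)))
  have hle : futureMax g T a ≤ max c (futureMax g T b) := by
    refine futureMax_le (le_max_of_le_right (le_max_left _ _)) fun s hs => ?_
    rcases le_total s b with hsb | hbs
    · exact le_max_of_le_left (hg s ⟨hs.1, hsb⟩)
    · exact le_max_of_le_right (le_futureMax hb' ⟨hbs, hs.2⟩)
  exact (le_max_iff.1 hle).resolve_left (hc.trans_le (futureMax_anti hb hat)).not_ge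

/-- The backward reflection term `K` increases only where `h(t) + K(T) − K(t) = 0`:
the Lebesgue–Stieltjes measure `dK` of `{t ∈ [0,T] : h(t) + K(T) − K(t) > 0}` is zero;
equivalently `∫_{[0,T]} (h(t) + K(T) − K(t)) dK(t) = 0`.  Here `μ` is the
Lebesgue–Stieltjes measure of `K`, characterized by `μ([a,b]) = K(b) − K(a)` for
subintervals of `[0,T]`. -/
theorem backwardK_flat_off (T : ℝ) (hT : 0 < T)
    (h : ℝ → ℝ) (hc : ContinuousOn h (Icc 0 T)) (hhT : 0 ≤ h T)
    (K : ℝ → ℝ)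
    (hK : ∀ t ∈ Icc 0 T, K t =
      max 0 (sSup ((fun s => -h s) '' Icc 0 T))
        - max 0 (sSup ((fun s => -h s) '' Icc t T)))
    (μ : Measure ℝ)
    (hμ : ∀ a b : ℝ, 0 ≤ a → a ≤ b → b ≤ T →
      μ (Icc a b) = ENNReal.ofReal (K b - K a)) :
    μ {t ∈ Icc 0 T | 0 < h t + K T - K t} = 0 ∧
      (∫ t in Icc 0 T, (h t + K T - K t) ∂μ) = 0 := by
  set g : ℝ → ℝ := fun s => -h s with hg
  have hgc : ContinuousOn g (Icc 0 T) := hc.neg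
  have hbdd : BddAbove (g '' Icc 0 T) := isCompact_Icc.bddAbove_image hgc
  have hK' : ∀ t ∈ Icc 0 T, K t = futureMax g T 0 - futureMax g T t := hK
  have hKT : K T = futureMax g T 0 := by
    rw [hK' T ⟨hT.le, le_rfl⟩, futureMax_self (g := g) (neg_nonpos.2 hhT), sub_zero]
  have hdiff : ∀ t ∈ Icc 0 T, h t + K T - K t = futureMax g T t - g t := by
    intro t ht
    rw [hKT, hK' t ht, hg]
    ring
  have hnull : μ {t ∈ Icc 0 T | 0 < h t + K T - K t} = 0 := by
    refine measure_null_of_locally_null _ fun t ⟨ht, hpos⟩ => ?_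
    rw [hdiff t ht, sub_pos] at hpos
    obtain ⟨c, hgt, hcR⟩ := exists_between hpos
    obtain ⟨δ, hδ, hδg⟩ := (nhdsWithin_hasBasis Metric.nhds_basis_closedBall _).eventually_iff.1
      ((hgc t ht).eventually_lt_const hgt)
    rw [Real.closedBall_eq_Icc] at hδg
    have ha : max 0 (t - δ) ≤ t := max_le ht.1 (by linarith)
    have hb : t ≤ min T (t + δ) := le_min ht.2 (by linarith)
    refine ⟨Icc (max 0 (t - δ)) (min T (t + δ)), ?_, ?_⟩
    · refine mem_nhdsWithin_iff_exists_mem_nhds_inter.2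
        ⟨Icc (t - δ) (t + δ), Icc_mem_nhds (by linarith) (by linarith), fun s hs => ?_⟩
      exact ⟨max_le hs.2.1.1 hs.1.1, le_min hs.2.1.2 hs.1.2⟩
    · have heq := futureMax_eq_of_lt
        (hbdd.mono (image_mono (Icc_subset_Icc_left (le_max_left 0 (t - δ))))) ha hb
        (fun s hs => (hδg ⟨⟨(le_max_right _ _).trans hs.1, hs.2.trans (min_le_right _ _)⟩,
          (le_max_left _ _).trans hs.1, hs.2.trans (min_le_left _ _)⟩).le) hcR
      rw [hμ _ _ (le_max_left _ _) (ha.trans hb) (min_le_left _ _),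
        hK' _ ⟨le_max_left _ _, ha.trans ht.2⟩, hK' _ ⟨ht.1.trans hb, min_le_left _ _⟩, heq]
      simp
  refine ⟨hnull, integral_eq_zero_of_ae ((ae_restrict_iff' measurableSet_Icc).2 ?_)⟩
  filter_upwards [measure_eq_zero_iff_ae_notMem.1 hnull] with t hpos ht
  refine le_antisymm (not_lt.1 fun hlt => hpos ⟨ht, hlt⟩) ?_
  rw [hdiff t ht]
  exact sub_nonneg.2 (le_futureMax
    (hbdd.mono (image_mono (Icc_subset_Icc_left ht.1))) ⟨le_rfl, ht.2⟩)
end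

section
/- Uniqueness of the backward reflection term: suppose K̄ : [0,T] → ℝ is continuous and nondecreasing with K̄(0) = 0, h(t) + K̄(T) − K̄(t) ≥ 0 for all t ∈ [0,T], and the Lebesgue–Stieltjes measure dK̄ of the set {t ∈ [0,T] : h(t) + K̄(T) − K̄(t) > 0} is zero. Then K̄(t) = max(0, max_{0≤s≤T}(−h(s))) − max(0, max_{t≤s≤T}(−h(s))) for every t ∈ [0,T]. -/
open Set MeasureTheory

/-- A point where the flatness condition is active: if `K` increases on `[t, T]`, then at the last
time `s` with `K s = K t` the reflected path `h + K T - K` vanishes. -/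
theorem exists_reflected_eq_zero {T : ℝ} {h K : ℝ → ℝ} (hc : ContinuousOn h (Icc 0 T))
    (hKc : ContinuousOn K (Icc 0 T)) (hKm : MonotoneOn K (Icc 0 T))
    (hpos : ∀ t ∈ Icc 0 T, 0 ≤ h t + K T - K t) {μ : Measure ℝ}
    (hμ : ∀ a b : ℝ, 0 ≤ a → a ≤ b → b ≤ T → μ (Icc a b) = ENNReal.ofReal (K b - K a))
    (hflat : μ {t ∈ Icc 0 T | 0 < h t + K T - K t} = 0)
    {t : ℝ} (ht : t ∈ Icc 0 T) (hlt : K t < K T) :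
    ∃ s ∈ Icc t T, -h s = K T - K t := by
  have hsub : Icc t T ⊆ Icc 0 T := Icc_subset_Icc_left ht.1
  have hcomp : IsCompact (Icc t T ∩ K ⁻¹' Iic (K t)) :=
    isCompact_Icc.of_isClosed_subset
      ((hKc.mono hsub).preimage_isClosed_of_isClosed isClosed_Icc isClosed_Iic) inter_subset_left
  obtain ⟨s, ⟨hs, hsK⟩, hmax⟩ := hcomp.exists_isGreatest ⟨t, ⟨le_rfl, ht.2⟩, le_refl (K t)⟩
  have hKs : K s = K t := le_antisymm hsK (hKm ht (hsub hs) hs.1)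
  have hsT : s < T := lt_of_le_of_ne hs.2 fun e => by
    rw [e] at hKs
    exact hlt.ne' hKs
  refine ⟨s, hs, ?_⟩
  by_contra hne
  have hgs : 0 < h s + K T - K s :=
    lt_of_le_of_ne (hpos s (hsub hs)) fun e => hne (by linarith)
  have hgc : ContinuousOn (fun x => h x + K T - K x) (Icc 0 T) :=
    (hc.add continuousOn_const).sub hKc
  have hev := (hgc s (hsub hs)).eventually (lt_mem_nhds hgs)
  obtain ⟨ε, hε, hball⟩ := Metric.mem_nhdsWithin_iff.mp hev
  obtain ⟨b, hsb, hb⟩ := exists_between (lt_min hsT (lt_add_of_pos_right s hε))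
  obtain ⟨hbT, hbε⟩ := lt_min_iff.mp hb
  have hs0 : 0 ≤ s := (hsub hs).1
  have hincl : Icc s b ⊆ {t ∈ Icc 0 T | 0 < h t + K T - K t} := fun x hx => by
    have hx' : x ∈ Icc 0 T := ⟨hs0.trans hx.1, hx.2.trans hbT.le⟩
    refine ⟨hx', hball ⟨?_, hx'⟩⟩
    rw [Metric.mem_ball, Real.dist_eq, abs_lt]
    constructor <;> linarith [hx.1, hx.2]
  have hzero := measure_mono_null hincl hflat
  rw [hμ s b hs0 hsb.le hbT.le, ENNReal.ofReal_eq_zero] at hzero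
  have hbmem : b ∈ Icc t T ∩ K ⁻¹' Iic (K t) :=
    ⟨⟨hs.1.trans hsb.le, hbT.le⟩, by
      rw [mem_preimage, mem_Iic]
      linarith⟩
  exact absurd (hmax hbmem) hsb.not_ge

/-- The remaining increase `K T - K t` is the running maximum of `-h` over `[t, T]`. -/
theorem max_sSup_neg_eq_sub {T : ℝ} {h K : ℝ → ℝ} (hc : ContinuousOn h (Icc 0 T))
    (hKc : ContinuousOn K (Icc 0 T)) (hKm : MonotoneOn K (Icc 0 T))
    (hpos : ∀ t ∈ Icc 0 T, 0 ≤ h t + K T - K t) {μ : Measure ℝ}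
    (hμ : ∀ a b : ℝ, 0 ≤ a → a ≤ b → b ≤ T → μ (Icc a b) = ENNReal.ofReal (K b - K a))
    (hflat : μ {t ∈ Icc 0 T | 0 < h t + K T - K t} = 0)
    {t : ℝ} (ht : t ∈ Icc 0 T) :
    max 0 (sSup ((fun s => -h s) '' Icc t T)) = K T - K t := by
  have hsub : Icc t T ⊆ Icc 0 T := Icc_subset_Icc_left ht.1
  have hT : T ∈ Icc 0 T := ⟨ht.1.trans ht.2, le_rfl⟩
  have hle : K t ≤ K T := hKm ht hT ht.2
  have hub : ∀ y ∈ (fun s => -h s) '' Icc t T, y ≤ K T - K t := by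
    rintro _ ⟨s, hs, rfl⟩
    linarith [hpos s (hsub hs), hKm ht (hsub hs) hs.1]
  refine le_antisymm (max_le (sub_nonneg.mpr hle)
    (csSup_le ((nonempty_Icc.mpr ht.2).image _) hub)) ?_
  rcases hle.eq_or_lt with heq | hlt
  · exact le_max_of_le_left (by linarith)
  · obtain ⟨s, hs, hse⟩ := exists_reflected_eq_zero hc hKc hKm hpos hμ hflat ht hlt
    exact le_max_of_le_right (le_csSup ⟨_, hub⟩ ⟨s, hs, hse⟩)

/-- Uniqueness of the backward reflection term: if `K̄` is continuous nondecreasing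
with `K̄(0) = 0`, `h(t) + K̄(T) − K̄(t) ≥ 0` on `[0,T]`, and the Lebesgue–Stieltjes
measure of `K̄` gives no mass to `{t : h(t) + K̄(T) − K̄(t) > 0}`, then
`K̄(t) = max(0, max_{0≤s≤T}(−h(s))) − max(0, max_{t≤s≤T}(−h(s)))` on `[0,T]`. -/
theorem backwardK_uniqueness (T : ℝ) (hT : 0 < T)
    (h : ℝ → ℝ) (hc : ContinuousOn h (Icc 0 T)) (hhT : 0 ≤ h T)
    (Kbar : ℝ → ℝ) (hKc : ContinuousOn Kbar (Icc 0 T))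
    (hKm : MonotoneOn Kbar (Icc 0 T)) (hK0 : Kbar 0 = 0)
    (hpos : ∀ t ∈ Icc 0 T, 0 ≤ h t + Kbar T - Kbar t)
    (μ : Measure ℝ)
    (hμ : ∀ a b : ℝ, 0 ≤ a → a ≤ b → b ≤ T →
      μ (Icc a b) = ENNReal.ofReal (Kbar b - Kbar a))
    (hflat : μ {t ∈ Icc 0 T | 0 < h t + Kbar T - Kbar t} = 0) :
    ∀ t ∈ Icc 0 T, Kbar t =
      max 0 (sSup ((fun s => -h s) '' Icc 0 T))
        - max 0 (sSup ((fun s => -h s) '' Icc t T)) := by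
  intro t ht
  rw [max_sSup_neg_eq_sub hc hKc hKm hpos hμ hflat ht,
    max_sSup_neg_eq_sub hc hKc hKm hpos hμ hflat ⟨le_rfl, hT.le⟩, hK0]
  ring
end

section
/- Lipschitz stability of the backward reflection term: let h, h' : [0,T] → ℝ be continuous with h(T) ≥ 0 and h'(T) ≥ 0, and let K and K' be defined from h and h' respectively by K(t) = max(0, max_{0≤s≤T}(−h(s))) − max(0, max_{t≤s≤T}(−h(s))) and similarly for K'. Then sup_{t∈[0,T]} |K(t) − K'(t)| ≤ 2 · max_{s∈[0,T]} |h(s) − h'(s)|. -/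
open Set

theorem Real.sSup_image_le_sSup_image_add {α : Type*} {S : Set α} (hS : S.Nonempty)
    {f g : α → ℝ} {C : ℝ} (hg : BddAbove (g '' S)) (hfg : ∀ x ∈ S, |f x - g x| ≤ C) :
    sSup (f '' S) ≤ sSup (g '' S) + C := by
  refine csSup_le (hS.image f) ?_
  rintro _ ⟨x, hx, rfl⟩
  linarith [le_csSup hg (mem_image_of_mem g hx), (abs_le.mp (hfg x hx)).2]

theorem Real.abs_sSup_image_sub_sSup_image_le {α : Type*} {S : Set α} (hS : S.Nonempty)
    {f g : α → ℝ} {C : ℝ} (hf : BddAbove (f '' S)) (hg : BddAbove (g '' S))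
    (hfg : ∀ x ∈ S, |f x - g x| ≤ C) :
    |sSup (f '' S) - sSup (g '' S)| ≤ C := by
  have hgf : ∀ x ∈ S, |g x - f x| ≤ C := fun x hx => abs_sub_comm (f x) (g x) ▸ hfg x hx
  rw [abs_sub_le_iff]
  constructor <;>
    linarith [sSup_image_le_sSup_image_add hS hg hfg, sSup_image_le_sSup_image_add hS hf hgf]

/-- Lipschitz stability of the backward reflection term:
`sup_{t∈[0,T]} |K(t) − K'(t)| ≤ 2 · max_{s∈[0,T]} |h(s) − h'(s)|`. -/
theorem backwardK_lipschitz (T : ℝ) (hT : 0 < T)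
    (h h' : ℝ → ℝ) (hc : ContinuousOn h (Icc 0 T)) (hc' : ContinuousOn h' (Icc 0 T))
    (hhT : 0 ≤ h T) (hhT' : 0 ≤ h' T)
    (K K' : ℝ → ℝ)
    (hK : ∀ t ∈ Icc 0 T, K t =
      max 0 (sSup ((fun s => -h s) '' Icc 0 T))
        - max 0 (sSup ((fun s => -h s) '' Icc t T)))
    (hK' : ∀ t ∈ Icc 0 T, K' t =
      max 0 (sSup ((fun s => -h' s) '' Icc 0 T))
        - max 0 (sSup ((fun s => -h' s) '' Icc t T))) :
    sSup ((fun t => |K t - K' t|) '' Icc 0 T)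
      ≤ 2 * sSup ((fun s => |h s - h' s|) '' Icc 0 T) := by
  set C := sSup ((fun s => |h s - h' s|) '' Icc 0 T)
  have hdist : ∀ s ∈ Icc 0 T, |-h s - -h' s| ≤ C := fun s hs => by
    rw [neg_sub_neg, abs_sub_comm]
    exact le_csSup (isCompact_Icc.bddAbove_image (hc.sub hc').abs) (mem_image_of_mem _ hs)
  have hmax : ∀ t ∈ Icc 0 T, |max 0 (sSup ((fun s => -h s) '' Icc t T))
      - max 0 (sSup ((fun s => -h' s) '' Icc t T))| ≤ C := fun t ht => by
    have hsub : Icc t T ⊆ Icc 0 T := Icc_subset_Icc_left ht.1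
    refine (abs_max_sub_max_le_max _ _ _ _).trans ?_
    rw [sub_self, abs_zero, max_eq_right (abs_nonneg _)]
    exact Real.abs_sSup_image_sub_sSup_image_le (nonempty_Icc.mpr ht.2)
      (isCompact_Icc.bddAbove_image (hc.neg.mono hsub))
      (isCompact_Icc.bddAbove_image (hc'.neg.mono hsub)) fun s hs => hdist s (hsub hs)
  refine csSup_le ((nonempty_Icc.mpr hT.le).image _) ?_
  rintro _ ⟨t, ht, rfl⟩
  dsimp only
  rw [hK t ht, hK' t ht, sub_sub_sub_comm, two_mul]
  exact (abs_sub _ _).trans (add_le_add (hmax 0 (left_mem_Icc.mpr hT.le)) (hmax t ht))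
end
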